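/- Let S and R be associative rings with identity and let T be an (S,R)-bimodule that is Wakamatsu tilting. If both the projective dimension of T as a left S-module and the projective dimension of T as a right R-module are finite, then T is a tilting right R-module; more precisely, T is an n-tilting right R-module for n = pd(T_R). -/

import Mathlib

/-!
Common definitions for formalizing the Wakamatsu tilting conjecture paper.
All rings are associative with identity; right `R`-modules are treated as
left `Rᵐᵒᵖ`-modules.
-/

open CategoryTheory

universe u

/-- Vanishing of `Ext^n_S(X, Y)` for left `S`-modules. -/
abbrev ExtVanish (S : Type u) [Ring S] (n : ℕ) (X Y : ModuleCat.{u} S) : Prop :=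
  Subsingleton (((Ext ℤ (ModuleCat.{u} S) n).obj (Opposite.op X)).obj Y)

/-- `N ∈ add_S T`: `N` is a direct summand of a finite direct sum of copies of `T`. -/
def MemAdd (S : Type u) [Ring S] (T N : ModuleCat.{u} S) : Prop :=
  ∃ (k : ℕ) (M : ModuleCat.{u} S), Nonempty ((↥N × ↥M) ≃ₗ[S] (Fin k → ↥T))

/-- `N ∈ gen*_S(T)`: there is an exact sequence `⋯ → X_1 → X_0 → N → 0` with all
`X_i ∈ add_S T` and `Ext^1_S(T, Ker f_i) = 0` for all `i ≥ 0`. -/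
def MemGenStar (S : Type u) [Ring S] (T N : ModuleCat.{u} S) : Prop :=
  ∃ (X : ℕ → ModuleCat.{u} S) (f : ∀ i, ↥(X (i + 1)) →ₗ[S] ↥(X i)) (f0 : ↥(X 0) →ₗ[S] ↥N),
    (∀ i, MemAdd S T (X i)) ∧
    Function.Surjective f0 ∧
    Function.Exact (f 0) f0 ∧
    (∀ i, Function.Exact (f (i + 1)) (f i)) ∧
    ExtVanish S 1 T (ModuleCat.of S (LinearMap.ker f0)) ∧
    (∀ i, ExtVanish S 1 T (ModuleCat.of S (LinearMap.ker (f i))))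

/-- The projective dimension of the left `S`-module `M` is at most `n`: there is a projective
resolution `0 → P_n → ⋯ → P_0 → M → 0`. -/
def PdLE (S : Type u) [Ring S] (M : ModuleCat.{u} S) (n : ℕ) : Prop :=
  ∃ (P : ℕ → ModuleCat.{u} S) (d : ∀ i, ↥(P (i + 1)) →ₗ[S] ↥(P i)) (ε : ↥(P 0) →ₗ[S] ↥M),
    (∀ i, Module.Projective S ↥(P i)) ∧
    Function.Surjective ε ∧
    Function.Exact (d 0) ε ∧
    (∀ i, Function.Exact (d (i + 1)) (d i)) ∧
    (∀ i, n < i → Subsingleton ↥(P i))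

/-- The projective dimension of `M` equals `n`. -/
def PdEq (S : Type u) [Ring S] (M : ModuleCat.{u} S) (n : ℕ) : Prop :=
  PdLE S M n ∧ ∀ m, PdLE S M m → n ≤ m

/-- `N ∈ T^⊥`: `Ext^i_S(T, N) = 0` for all `i ≥ 1`. -/
def MemPerp (S : Type u) [Ring S] (T N : ModuleCat.{u} S) : Prop :=
  ∀ i, 1 ≤ i → ExtVanish S i T N

/-- `N ∈ X_T = T^⊥ ∩ gen*_S(T)`. -/
def MemXT (S : Type u) [Ring S] (T N : ModuleCat.{u} S) : Prop :=
  MemPerp S T N ∧ MemGenStar S T N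

/-- There is an exact sequence `0 → B → X_0 → ⋯ → X_n → 0` with all `X_i ∈ add_S T`. -/
def HasFiniteAddCoresolution (S : Type u) [Ring S] (T B : ModuleCat.{u} S) (n : ℕ) : Prop :=
  ∃ (X : ℕ → ModuleCat.{u} S) (g : ∀ i, ↥(X i) →ₗ[S] ↥(X (i + 1))) (g0 : ↥B →ₗ[S] ↥(X 0)),
    (∀ i, i ≤ n → MemAdd S T (X i)) ∧
    (∀ i, n < i → Subsingleton ↥(X i)) ∧
    Function.Injective g0 ∧
    Function.Exact g0 (g 0) ∧
    (∀ i, Function.Exact (g i) (g (i + 1)))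

/-- `T` is an `n`-tilting left `A`-module (Miyashita); applying this with `A = Rᵐᵒᵖ`
gives the notion for right `R`-modules. -/
def IsNTilting (A : Type u) [Ring A] (T : ModuleCat.{u} A) (n : ℕ) : Prop :=
  MemGenStar A (ModuleCat.of A A) T ∧
  PdLE A T n ∧
  (∀ i, 0 < i → ExtVanish A i T T) ∧
  HasFiniteAddCoresolution A T (ModuleCat.of A A) n

/-- `T` is a Wakamatsu tilting left `A`-module (Definition 2.2); applying this with
`A = Rᵐᵒᵖ` gives the notion for right `R`-modules: `T ∈ gen*(A)`, `Ext^i_A(T,T) = 0` for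
`i > 0`, and there is an exact sequence `0 → A → X_0 → X_1 → ⋯` with `X_i ∈ add T`
which stays exact after applying `Hom_A(-, T)`. -/
def IsWakamatsuTilting (A : Type u) [Ring A] (T : ModuleCat.{u} A) : Prop :=
  MemGenStar A (ModuleCat.of A A) T ∧
  (∀ i, 0 < i → ExtVanish A i T T) ∧
  ∃ (X : ℕ → ModuleCat.{u} A) (g : ∀ i, ↥(X i) →ₗ[A] ↥(X (i + 1))) (g0 : A →ₗ[A] ↥(X 0)),
    (∀ i, MemAdd A T (X i)) ∧
    Function.Injective g0 ∧
    Function.Exact g0 (g 0) ∧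
    (∀ i, Function.Exact (g i) (g (i + 1))) ∧
    Function.Surjective (fun h : ↥(X 0) →ₗ[A] ↥T => h.comp g0) ∧
    Function.Exact (fun h : ↥(X 1) →ₗ[A] ↥T => h.comp (g 0))
      (fun h : ↥(X 0) →ₗ[A] ↥T => h.comp g0) ∧
    (∀ i, Function.Exact (fun h : ↥(X (i + 2)) →ₗ[A] ↥T => h.comp (g (i + 1)))
      (fun h : ↥(X (i + 1)) →ₗ[A] ↥T => h.comp (g i)))

/-- The subgroup of `T ⊗_ℤ M` generated by the balancing relations `(t·r) ⊗ m - t ⊗ (r·m)`;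
the quotient of `T ⊗_ℤ M` by it is the balanced tensor product `T ⊗_R M`. -/
noncomputable def TensorRel (R : Type u) [Ring R] (T : Type u) [AddCommGroup T]
    [Module Rᵐᵒᵖ T] (M : Type u) [AddCommGroup M] [Module R M] :
    AddSubgroup (TensorProduct ℤ T M) :=
  AddSubgroup.closure
    {x | ∃ (t : T) (r : R) (m : M),
      x = (MulOpposite.op r • t) ⊗ₜ[ℤ] m - t ⊗ₜ[ℤ] (r • m)}

/-- The right `R`-module `T` is tensorly faithful: `T ⊗_R M ≠ 0` for every nonzero left
`R`-module `M` (equivalently, the balancing relations do not exhaust `T ⊗_ℤ M`). -/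
def TensorlyFaithful (R : Type u) [Ring R] (T : Type u) [AddCommGroup T]
    [Module Rᵐᵒᵖ T] : Prop :=
  ∀ (M : Type u) [AddCommGroup M] [Module R M], Nontrivial M → TensorRel R T M ≠ ⊤

/-- The natural ring homomorphism `Rᵐᵒᵖ →+* End(_S T)` induced by the right `R`-action;
it being bijective says exactly that `R → End(_S T)ᵒᵖ` is an isomorphism. -/
def rightEndNat (S R : Type u) [Ring S] [Ring R] (T : Type u) [AddCommGroup T] [Module S T]
    [Module Rᵐᵒᵖ T] [SMulCommClass S Rᵐᵒᵖ T] : Rᵐᵒᵖ →+* Module.End S T :=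
  haveI := SMulCommClass.symm S Rᵐᵒᵖ T
  Module.toModuleEnd S T

/-- The bimodule `T` is Wakamatsu tilting, i.e. a semidualizing `(S,R)`-bimodule
(Lemma 2.3(iii)). -/
def IsSemidualizing (S R : Type u) [Ring S] [Ring R] (T : Type u) [AddCommGroup T]
    [Module S T] [Module Rᵐᵒᵖ T] [SMulCommClass S Rᵐᵒᵖ T] : Prop :=
  MemGenStar Rᵐᵒᵖ (ModuleCat.of Rᵐᵒᵖ Rᵐᵒᵖ) (ModuleCat.of Rᵐᵒᵖ T) ∧
  MemGenStar S (ModuleCat.of S S) (ModuleCat.of S T) ∧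
  Function.Bijective (Module.toModuleEnd Rᵐᵒᵖ T : S →+* Module.End Rᵐᵒᵖ T) ∧
  Function.Bijective (rightEndNat S R T) ∧
  (∀ i, 0 < i → ExtVanish Rᵐᵒᵖ i (ModuleCat.of Rᵐᵒᵖ T) (ModuleCat.of Rᵐᵒᵖ T)) ∧
  (∀ i, 0 < i → ExtVanish S i (ModuleCat.of S T) (ModuleCat.of S T))

/-- The left `R`-module structure on `Hom_S(T, M)` given by `(r • f) t = f (t · r)`. -/
def homModule (S R : Type u) [Ring S] [Ring R] (T : Type u) [AddCommGroup T] [Module S T]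
    [Module Rᵐᵒᵖ T] [SMulCommClass S Rᵐᵒᵖ T] (M : Type u) [AddCommGroup M] [Module S M] :
    Module R (T →ₗ[S] M) where
  smul r f :=
    { toFun := fun t => f (MulOpposite.op r • t)
      map_add' := fun t₁ t₂ => by
        show f (MulOpposite.op r • (t₁ + t₂)) = _
        rw [smul_add, map_add]
      map_smul' := fun s t => by
        show f (MulOpposite.op r • (s • t)) = s • f (MulOpposite.op r • t)
        rw [← smul_comm s (MulOpposite.op r) t, map_smul] }
  one_smul f := by
    apply LinearMap.ext; intro t
    show f ((MulOpposite.op (1 : R)) • t) = f t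
    rw [MulOpposite.op_one, one_smul]
  mul_smul r₁ r₂ f := by
    apply LinearMap.ext; intro t
    show f ((MulOpposite.op (r₁ * r₂)) • t) = f (MulOpposite.op r₂ • MulOpposite.op r₁ • t)
    rw [MulOpposite.op_mul, mul_smul]
  smul_zero r := by apply LinearMap.ext; intro t; rfl
  smul_add r f g := by apply LinearMap.ext; intro t; rfl
  add_smul r₁ r₂ f := by
    apply LinearMap.ext; intro t
    show f ((MulOpposite.op (r₁ + r₂)) • t) = f (MulOpposite.op r₁ • t) + f (MulOpposite.op r₂ • t)
    rw [MulOpposite.op_add, add_smul, map_add]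
  zero_smul f := by
    apply LinearMap.ext; intro t
    show f ((MulOpposite.op (0 : R)) • t) = 0
    rw [MulOpposite.op_zero, zero_smul, map_zero]

/-- The evaluation map `T ⊗_ℤ Hom_S(T, M) → M`, `t ⊗ h ↦ h t`. -/
noncomputable def evalMap (S : Type u) [Ring S] (T : Type u) [AddCommGroup T] [Module S T]
    (M : Type u) [AddCommGroup M] [Module S M] :
    TensorProduct ℤ T (T →ₗ[S] M) →ₗ[ℤ] M :=
  TensorProduct.lift
    (LinearMap.mk₂ ℤ (fun t h => h t)
      (fun t₁ t₂ h => by show h (t₁ + t₂) = h t₁ + h t₂; rw [map_add])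
      (fun z t h => by show h (z • t) = z • h t; rw [map_zsmul])
      (fun t h₁ h₂ => rfl)
      (fun z t h => rfl))

/-- `Tor^R_i(T, N) = 0` for all `i ≥ 1`: for every projective resolution `P_•` of the left
`R`-module `N`, the induced complex `T ⊗_R P_•` is exact in positive degrees (expressed
via the presentation of `T ⊗_R -` as a quotient of `T ⊗_ℤ -` by the balancing relations). -/
def TorVanishPos (R : Type u) [Ring R] (T : Type u) [AddCommGroup T] [Module Rᵐᵒᵖ T]
    (N : Type u) [AddCommGroup N] [Module R N] : Prop :=
  ∀ (P : ℕ → ModuleCat.{u} R) (d : ∀ i, ↥(P (i + 1)) →ₗ[R] ↥(P i)) (ε : ↥(P 0) →ₗ[R] N),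
    (∀ i, Module.Projective R ↥(P i)) → Function.Surjective ε →
    Function.Exact (d 0) ε → (∀ i, Function.Exact (d (i + 1)) (d i)) →
    ∀ (i : ℕ) (x : TensorProduct ℤ T ↥(P (i + 1))),
      TensorProduct.map (LinearMap.id : T →ₗ[ℤ] T)
          ((d i).toAddMonoidHom.toIntLinearMap) x ∈ TensorRel R T ↥(P i) →
      ∃ y : TensorProduct ℤ T ↥(P (i + 2)),
        x - TensorProduct.map (LinearMap.id : T →ₗ[ℤ] T)
          ((d (i + 1)).toAddMonoidHom.toIntLinearMap) y ∈ TensorRel R T ↥(P (i + 1))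

/-- `M` belongs to the Bass class `B_T(S)`: the evaluation map
`T ⊗_R Hom_S(T, M) → M` is an isomorphism (it is surjective, and its kernel is exactly the
subgroup of balancing relations), `Ext^i_S(T, M) = 0` and `Tor^R_i(T, Hom_S(T, M)) = 0`
for all `i ≥ 1`. -/
def MemBass (S R : Type u) [Ring S] [Ring R] (T : Type u) [AddCommGroup T] [Module S T]
    [Module Rᵐᵒᵖ T] [SMulCommClass S Rᵐᵒᵖ T] (M : Type u) [AddCommGroup M] [Module S M] :
    Prop :=
  letI := homModule S R T M
  Function.Surjective (evalMap S T M) ∧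
  (∀ x, evalMap S T M x = 0 ↔ x ∈ TensorRel R T (T →ₗ[S] M)) ∧
  (∀ i, 1 ≤ i → ExtVanish S i (ModuleCat.of S T) (ModuleCat.of S M)) ∧
  TorVanishPos R T (T →ₗ[S] M)

/-- `R` is a left max ring: every nonzero left `R`-module has a maximal (proper) submodule. -/
def IsLeftMaxRing (R : Type u) [Ring R] : Prop :=
  ∀ (M : Type u) [AddCommGroup M] [Module R M], Nontrivial M → ∃ N : Submodule R M, IsCoatom N

/-- `R` is left Kasch: every simple quotient `R/n` by a maximal left ideal embeds as a
left ideal of `R`. -/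
def IsLeftKasch (R : Type u) [Ring R] : Prop :=
  ∀ n : Submodule R R, IsCoatom n → ∃ I : Submodule R R, Nonempty ((R ⧸ n) ≃ₗ[R] ↥I)

/-- An elementary projective resolution of a module gives a `ProjectiveResolution`. -/
theorem exists_projectiveResolution {A : Type u} [Ring A] {M : ModuleCat.{u} A}
    (P : ℕ → ModuleCat.{u} A) (d : ∀ i, ↥(P (i + 1)) →ₗ[A] ↥(P i)) (ε : ↥(P 0) →ₗ[A] ↥M)
    (hP : ∀ i, Module.Projective A ↥(P i)) (hε : Function.Surjective ε)
    (h0 : Function.Exact (d 0) ε) (hd : ∀ i, Function.Exact (d (i + 1)) (d i)) :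
    ∃ Q : ProjectiveResolution M, Q.complex = ChainComplex.of P (fun i => ModuleCat.ofHom (d i))
      (fun i => by ext x; exact (hd i).apply_apply_eq_zero x) := by
  have sq : ∀ i, ModuleCat.ofHom (d (i + 1)) ≫ ModuleCat.ofHom (d i) = 0 := fun i => by
    ext x; exact (hd i).apply_apply_eq_zero x
  let K := ChainComplex.of P (fun i => ModuleCat.ofHom (d i)) sq
  have hK : ∀ i, K.d (i + 1) i = ModuleCat.ofHom (d i) := fun i => by simp [K]
  have w : K.d 1 0 ≫ ModuleCat.ofHom ε = 0 := by
    rw [hK 0]; ext x; exact h0.apply_apply_eq_zero x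
  refine ⟨{ complex := K
            projective := fun n => (IsProjective.iff_projective (P n)).1 (hP n)
            π := (ChainComplex.toSingle₀Equiv _ _).symm ⟨ModuleCat.ofHom ε, w⟩
            quasiIso := ⟨fun n => ?_⟩ }, rfl⟩
  cases n with
  | zero =>
    rw [ChainComplex.quasiIsoAt₀_iff, ShortComplex.quasiIso_iff_of_zeros' _ rfl rfl rfl]
    constructor
    · rw [ShortComplex.moduleCat_exact_iff]
      intro x hx
      obtain ⟨y, hy⟩ := (h0 x).1 (by simp at hx; exact hx)
      refine ⟨y, ?_⟩
      change (K.d 1 0).hom y = x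
      rw [hK 0]
      exact hy
    · have : Epi (ModuleCat.ofHom ε) := (ModuleCat.epi_iff_surjective _).2 hε
      simp
      exact this
  | succ n =>
    rw [quasiIsoAt_iff_exactAt',
      HomologicalComplex.exactAt_iff' _ (n + 1 + 1) (n + 1) n (by simp) (by simp)]
    · rw [ShortComplex.moduleCat_exact_iff]
      intro x hx
      change (K.d (n + 1) n).hom x = 0 at hx
      rw [hK n] at hx
      obtain ⟨y, hy⟩ := (hd n x).1 hx
      refine ⟨y, ?_⟩
      change (K.d (n + 1 + 1) (n + 1)).hom y = x
      rw [hK (n + 1)]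
      exact hy
    · exact ChainComplex.exactAt_succ_single_obj _ _

/-- The complex `P₂ → P₁ → P₀` becomes exact at `P₁` after applying `Hom(-, Y)`. -/
def HomExact {A P₂ P₁ P₀ : Type*} [Ring A] [AddCommGroup P₂] [Module A P₂]
    [AddCommGroup P₁] [Module A P₁] [AddCommGroup P₀] [Module A P₀]
    (d' : P₂ →ₗ[A] P₁) (d : P₁ →ₗ[A] P₀) (Y : Type*) [AddCommGroup Y] [Module A Y] : Prop :=
  ∀ f : P₁ →ₗ[A] Y, f ∘ₗ d' = 0 → ∃ g : P₀ →ₗ[A] Y, g ∘ₗ d = f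

/-- `Ext` groups vanish iff `Hom(P, Y)` is exact, for a projective resolution `P`. -/
theorem subsingleton_ext_iff {A : Type u} [Ring A] {M : ModuleCat.{u} A}
    (P : ℕ → ModuleCat.{u} A) (d : ∀ i, ↥(P (i + 1)) →ₗ[A] ↥(P i)) (ε : ↥(P 0) →ₗ[A] ↥M)
    (hP : ∀ i, Module.Projective A ↥(P i)) (hε : Function.Surjective ε)
    (h0 : Function.Exact (d 0) ε) (hd : ∀ i, Function.Exact (d (i + 1)) (d i))
    (Y : ModuleCat.{u} A) (n : ℕ) :
    ExtVanish A (n + 1) M Y ↔ HomExact (d (n + 1)) (d n) ↥Y := by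
  obtain ⟨Q, hQ⟩ := exists_projectiveResolution P d ε hP hε h0 hd
  have key : (Q.complex.linearYonedaObj ℤ Y).ExactAt (n + 1) ↔ HomExact (d (n + 1)) (d n) ↥Y := by
    rw [hQ, HomologicalComplex.exactAt_iff' _ n (n + 1) (n + 1 + 1) (by simp) (by simp),
      ShortComplex.moduleCat_exact_iff]
    set K := ChainComplex.of P (fun i => ModuleCat.ofHom (d i))
        (fun i => by ext x; exact (hd i).apply_apply_eq_zero x)
    have hdK : ∀ i, K.d (i + 1) i = ModuleCat.ofHom (d i) := fun i => by simp [K]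
    constructor
    · intro h f hf
      obtain ⟨g, hg⟩ := h (ModuleCat.ofHom f) (by
        change K.d (n + 1 + 1) (n + 1) ≫ (ModuleCat.ofHom f : P (n + 1) ⟶ Y) = 0
        rw [hdK (n + 1), ← ModuleCat.ofHom_comp, hf]
        rfl)
      change K.d (n + 1) n ≫ (show P n ⟶ Y from g) = _ at hg
      rw [hdK n] at hg
      exact ⟨g.hom, congrArg ModuleCat.Hom.hom hg⟩
    · intro h f hf
      change K.d (n + 1 + 1) (n + 1) ≫ (show P (n + 1) ⟶ Y from f) = 0 at hf
      rw [hdK (n + 1)] at hf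
      obtain ⟨g, hg⟩ := h f.hom (congrArg ModuleCat.Hom.hom hf)
      refine ⟨ModuleCat.ofHom g, ?_⟩
      change K.d (n + 1) n ≫ (ModuleCat.ofHom g : P n ⟶ Y) = (show P (n + 1) ⟶ Y from f)
      rw [hdK n, ← ModuleCat.ofHom_comp, hg]
      rfl
  rw [← key, HomologicalComplex.exactAt_iff_isZero_homology, ExtVanish,
    (Q.isoExt (R := ℤ) (n + 1) Y).toLinearEquiv.toEquiv.subsingleton_congr,
    ModuleCat.isZero_iff_subsingleton]

/-- The objects of `add T` are the retracts of finite powers of `T`. -/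
theorem memAdd_iff {A : Type u} [Ring A] {T X : ModuleCat.{u} A} :
    MemAdd A T X ↔ ∃ (k : ℕ) (i : ↥X →ₗ[A] (Fin k → ↥T)) (r : (Fin k → ↥T) →ₗ[A] ↥X),
      r ∘ₗ i = LinearMap.id := by
  constructor
  · rintro ⟨k, M, ⟨e⟩⟩
    refine ⟨k, e.toLinearMap ∘ₗ LinearMap.inl A ↥X ↥M,
      LinearMap.fst A ↥X ↥M ∘ₗ e.symm.toLinearMap, ?_⟩
    ext x
    simp
  · rintro ⟨k, i, r, h⟩
    have h' : ∀ x, r (i x) = x := LinearMap.congr_fun h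
    have hq : ∀ y, (LinearMap.id - i ∘ₗ r : Module.End A (Fin k → ↥T)) y ∈ LinearMap.ker r :=
      fun y => by simp [h']
    refine ⟨k, ModuleCat.of A (LinearMap.ker r), ⟨LinearEquiv.ofLinearMap
      (i.coprod (LinearMap.ker r).subtype)
      (r.prod ((LinearMap.id - i ∘ₗ r).codRestrict (LinearMap.ker r) hq)) ?_ ?_⟩⟩
    · refine LinearMap.ext fun x => ?_
      simp
    · refine LinearMap.ext fun ⟨x, y, hy⟩ => ?_
      have hy' : r y = 0 := hy
      ext <;> simp [h', hy']

theorem MemAdd.of_retract {A : Type u} [Ring A] {T X K : ModuleCat.{u} A} (hX : MemAdd A T X)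
    (i : ↥K →ₗ[A] ↥X) (r : ↥X →ₗ[A] ↥K) (h : r ∘ₗ i = LinearMap.id) : MemAdd A T K := by
  obtain ⟨k, i', r', h'⟩ := memAdd_iff.1 hX
  refine memAdd_iff.2 ⟨k, i' ∘ₗ i, r ∘ₗ r', ?_⟩
  rw [LinearMap.comp_assoc, ← LinearMap.comp_assoc i, h', LinearMap.id_comp, h]

theorem MemAdd.of_linearEquiv {A : Type u} [Ring A] {T X K : ModuleCat.{u} A}
    (hX : MemAdd A T X) (e : ↥K ≃ₗ[A] ↥X) : MemAdd A T K :=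
  hX.of_retract e.toLinearMap e.symm.toLinearMap (by ext; simp)

theorem memAdd_of_subsingleton {A : Type u} [Ring A] (T K : ModuleCat.{u} A)
    [Subsingleton ↥K] : MemAdd A T K :=
  memAdd_iff.2 ⟨0, 0, 0, LinearMap.ext fun _ => Subsingleton.elim _ _⟩

theorem MemAdd.projective {A : Type u} [Ring A] {X : ModuleCat.{u} A}
    (hX : MemAdd A (ModuleCat.of A A) X) : Module.Projective A ↥X := by
  obtain ⟨k, i, r, h⟩ := memAdd_iff.1 hX
  exact Module.Projective.of_split (M := Fin k → A) i r h

/-- `Hom_S(-, T)` takes `add_S S` to `add_A T`, for a module `T` with commuting actions. -/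
theorem MemAdd.hom {S A T : Type u} [Ring S] [Ring A] [AddCommGroup T] [Module S T] [Module A T]
    [SMulCommClass S A T] {X : ModuleCat.{u} S} (hX : MemAdd S (ModuleCat.of S S) X) :
    MemAdd A (ModuleCat.of A T) (ModuleCat.of A (↥X →ₗ[S] T)) := by
  obtain ⟨k, i, r, h⟩ := memAdd_iff.1 hX
  let e : (Fin k → T) ≃ₗ[A] (Fin k → S) →ₗ[S] T := (Pi.basisFun S (Fin k)).constr A
  let pre {M N : Type u} [AddCommGroup M] [Module S M] [AddCommGroup N] [Module S N]
      (f : M →ₗ[S] N) : (N →ₗ[S] T) →ₗ[A] (M →ₗ[S] T) :=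
    { toFun := fun h => h ∘ₗ f
      map_add' := fun _ _ => rfl
      map_smul' := fun _ _ => rfl }
  refine memAdd_iff.2 ⟨k, e.symm.toLinearMap ∘ₗ pre r, pre i ∘ₗ e.toLinearMap, ?_⟩
  refine LinearMap.ext fun φ => ?_
  change (e (e.symm (φ ∘ₗ r))) ∘ₗ i = φ
  rw [e.apply_symm_apply, LinearMap.comp_assoc]
  exact (congrArg (φ ∘ₗ ·) h).trans (LinearMap.comp_id φ)

theorem exists_factor_of_exact {A P₁ P₀ T X : Type*} [Ring A] [AddCommGroup P₁] [Module A P₁]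
    [AddCommGroup P₀] [Module A P₀] [AddCommGroup T] [Module A T] [AddCommGroup X] [Module A X]
    {d : P₁ →ₗ[A] P₀} {ε : P₀ →ₗ[A] T} (hε : Function.Surjective ε) (h0 : Function.Exact d ε)
    (h : P₀ →ₗ[A] X) (hh : h ∘ₗ d = 0) : ∃ ψ : T →ₗ[A] X, ψ ∘ₗ ε = h := by
  have hker : LinearMap.ker ε ≤ LinearMap.ker h := by
    intro x hx
    obtain ⟨y, rfl⟩ := (h0 x).1 hx
    exact LinearMap.congr_fun hh y
  refine ⟨(LinearMap.ker ε).liftQ h hker ∘ₗ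
    (ε.quotKerEquivOfSurjective hε).symm.toLinearMap, LinearMap.ext fun x => ?_⟩
  have : (ε.quotKerEquivOfSurjective hε).symm (ε x) = Submodule.Quotient.mk x := by
    rw [LinearEquiv.symm_apply_eq]
    rfl
  simp [this]

section HomExact

variable {A : Type u} [Ring A] {P₃ P₂ P₁ P₀ : Type u}
  [AddCommGroup P₃] [Module A P₃] [AddCommGroup P₂] [Module A P₂]
  [AddCommGroup P₁] [Module A P₁] [AddCommGroup P₀] [Module A P₀]

theorem HomExact.of_memAdd {d' : P₂ →ₗ[A] P₁} {d : P₁ →ₗ[A] P₀} {T X : ModuleCat.{u} A}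
    (hT : HomExact d' d ↥T) (hX : MemAdd A T X) : HomExact d' d ↥X := by
  obtain ⟨k, i, r, h⟩ := memAdd_iff.1 hX
  intro f hf
  have : ∀ j, ∃ g : P₀ →ₗ[A] ↥T, g ∘ₗ d = LinearMap.proj j ∘ₗ i ∘ₗ f := fun j =>
    hT _ (by rw [LinearMap.comp_assoc, LinearMap.comp_assoc, hf, LinearMap.comp_zero,
      LinearMap.comp_zero])
  choose g hg using this
  refine ⟨r ∘ₗ LinearMap.pi g, ?_⟩
  have : LinearMap.pi g ∘ₗ d = i ∘ₗ f := by
    ext x j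
    exact LinearMap.congr_fun (hg j) x
  rw [LinearMap.comp_assoc, this, ← LinearMap.comp_assoc, h, LinearMap.id_comp]

/-- A cochain with values in a quotient `X / K` whose coboundary is zero lifts, up to a cochain
with values in `K`, to a cocycle with values in `X`. -/
theorem exists_lift_cocycle {d' : P₂ →ₗ[A] P₁} {d'' : P₃ →ₗ[A] P₂}
    {K X K' : Type u} [AddCommGroup K] [Module A K] [AddCommGroup X] [Module A X]
    [AddCommGroup K'] [Module A K'] [Module.Projective A P₁]
    (hd : d' ∘ₗ d'' = 0) {ι : K →ₗ[A] X} {p : X →ₗ[A] K'} (hι : Function.Injective ι)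
    (hp : Function.Surjective p) (hex : Function.Exact ι p) (hK : HomExact d'' d' K)
    (f : P₁ →ₗ[A] K') (hf : f ∘ₗ d' = 0) : ∃ h : P₁ →ₗ[A] X, p ∘ₗ h = f ∧ h ∘ₗ d' = 0 := by
  obtain ⟨h, hh⟩ := Module.projective_lifting_property p f hp
  have hmem : ∀ x, h (d' x) ∈ LinearMap.range ι := fun x => by
    refine (hex _).1 ?_
    rw [← LinearMap.comp_apply p, hh]
    exact LinearMap.congr_fun hf x
  let e := LinearEquiv.ofInjective ι hι
  let c : P₂ →ₗ[A] K := e.symm.toLinearMap ∘ₗ (h ∘ₗ d').codRestrict _ hmem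
  have hc : ι ∘ₗ c = h ∘ₗ d' := by
    ext x
    exact congrArg Subtype.val (e.apply_symm_apply ⟨h (d' x), hmem x⟩)
  obtain ⟨b, hb⟩ := hK c (by
    refine LinearMap.ext fun x => hι ?_
    have h1 := LinearMap.congr_fun hc (d'' x)
    have h2 := LinearMap.congr_fun hd x
    simp only [LinearMap.comp_apply, LinearMap.zero_apply] at h1 h2 ⊢
    rw [h1, h2, map_zero, map_zero])
  refine ⟨h - ι ∘ₗ b, ?_, ?_⟩
  · rw [LinearMap.comp_sub, hh, ← LinearMap.comp_assoc, hex.linearMap_comp_eq_zero,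
      LinearMap.zero_comp, sub_zero]
  · rw [LinearMap.sub_comp, LinearMap.comp_assoc, hb, hc, sub_self]

/-- Dimension shifting along a short exact sequence `0 → K → X → K' → 0`. -/
theorem HomExact.shift {d' : P₂ →ₗ[A] P₁} {d : P₁ →ₗ[A] P₀} {d'' : P₃ →ₗ[A] P₂}
    {K X K' : Type u} [AddCommGroup K] [Module A K] [AddCommGroup X] [Module A X]
    [AddCommGroup K'] [Module A K'] [Module.Projective A P₁]
    (hd : d' ∘ₗ d'' = 0) {ι : K →ₗ[A] X} {p : X →ₗ[A] K'} (hι : Function.Injective ι)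
    (hp : Function.Surjective p) (hex : Function.Exact ι p) (hK : HomExact d'' d' K)
    (hX : HomExact d' d X) : HomExact d' d K' := by
  intro f hf
  obtain ⟨h, rfl, hh⟩ := exists_lift_cocycle (ι := ι) hd hι hp hex hK f hf
  obtain ⟨g, rfl⟩ := hX h hh
  exact ⟨p ∘ₗ g, LinearMap.comp_assoc _ _ _⟩

/-- If `Ext¹(T, K) = 0`, every map from `T` to `K'` lifts along `0 → K → X → K' → 0`. -/
theorem HomExact.exists_lift {d' : P₂ →ₗ[A] P₁} {d : P₁ →ₗ[A] P₀}
    {T K X K' : Type u} [AddCommGroup T] [Module A T] [AddCommGroup K] [Module A K]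
    [AddCommGroup X] [Module A X] [AddCommGroup K'] [Module A K'] [Module.Projective A P₀]
    (hd : d ∘ₗ d' = 0) {ι : K →ₗ[A] X} {p : X →ₗ[A] K'} (hι : Function.Injective ι)
    (hp : Function.Surjective p) (hex : Function.Exact ι p) (hK : HomExact d' d K)
    {ε : P₀ →ₗ[A] T} (hε : Function.Surjective ε) (h0 : Function.Exact d ε) (φ : T →ₗ[A] K') :
    ∃ ψ : T →ₗ[A] X, p ∘ₗ ψ = φ := by
  obtain ⟨h, hh, hh'⟩ := exists_lift_cocycle (ι := ι) hd hι hp hex hK (φ ∘ₗ ε)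
    (by rw [LinearMap.comp_assoc, h0.linearMap_comp_eq_zero, LinearMap.comp_zero])
  obtain ⟨ψ, rfl⟩ := exists_factor_of_exact hε h0 h hh'
  refine ⟨ψ, LinearMap.ext fun t => ?_⟩
  obtain ⟨x, rfl⟩ := hε t
  exact LinearMap.congr_fun hh x

end HomExact

/-- A surjection onto an object of `add T` splits if all maps from `T` lift along it. -/
theorem MemAdd.exists_section {A : Type u} [Ring A] {T Z : ModuleCat.{u} A} (hZ : MemAdd A T Z)
    {X : Type u} [AddCommGroup X] [Module A X] (p : X →ₗ[A] ↥Z)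
    (hp : ∀ φ : ↥T →ₗ[A] ↥Z, ∃ ψ : ↥T →ₗ[A] X, p ∘ₗ ψ = φ) :
    ∃ s : ↥Z →ₗ[A] X, p ∘ₗ s = LinearMap.id := by
  obtain ⟨k, i, r, h⟩ := memAdd_iff.1 hZ
  choose ψ hψ using fun j => hp (r ∘ₗ LinearMap.single A (fun _ : Fin k => ↥T) j)
  refine ⟨LinearMap.lsum A (fun _ => ↥T) ℕ ψ ∘ₗ i, ?_⟩
  rw [← LinearMap.comp_assoc, ← h]
  congr 1
  refine LinearMap.pi_ext' fun j => ?_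
  rw [← hψ j]
  ext x
  change p (LinearMap.lsum A (fun _ : Fin k => ↥T) ℕ ψ (Pi.single j x)) = p (ψ j x)
  rw [LinearMap.lsum_piSingle]

theorem hasFiniteAddCoresolution_zero {A : Type u} [Ring A] {T B : ModuleCat.{u} A}
    (hB : MemAdd A T B) : HasFiniteAddCoresolution A T B 0 := by
  refine ⟨fun | 0 => B | _ + 1 => ModuleCat.of A PUnit, fun _ => 0, LinearMap.id, ?_, ?_,
    fun _ _ h => h, ?_, ?_⟩
  · intro i hi
    obtain rfl : i = 0 := Nat.le_zero.1 hi
    exact hB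
  · rintro (_ | i) hi
    · exact absurd hi (lt_irrefl 0)
    · exact inferInstanceAs (Subsingleton PUnit)
  · exact fun x => ⟨fun _ => ⟨x, rfl⟩, fun _ => rfl⟩
  · exact fun i x => ⟨fun _ => ⟨0, Subsingleton.elim (α := PUnit) _ _⟩, fun _ => rfl⟩

theorem HasFiniteAddCoresolution.cons {A : Type u} [Ring A] {T B X₀ K : ModuleCat.{u} A} {n : ℕ}
    (hK : HasFiniteAddCoresolution A T K n) (hX₀ : MemAdd A T X₀) (ι : ↥B →ₗ[A] ↥X₀)
    (p : ↥X₀ →ₗ[A] ↥K) (hι : Function.Injective ι) (hp : Function.Surjective p)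
    (hex : Function.Exact ι p) : HasFiniteAddCoresolution A T B (n + 1) := by
  obtain ⟨X, g, g0, hX, hX', hg0, he0, he⟩ := hK
  refine ⟨fun | 0 => X₀ | i + 1 => X i, fun | 0 => g0 ∘ₗ p | i + 1 => g i, ι, ?_, ?_, hι, ?_, ?_⟩
  · rintro (_ | i) hi
    · exact hX₀
    · exact hX i (Nat.le_of_succ_le_succ hi)
  · rintro (_ | i) hi
    · exact absurd hi (Nat.not_lt_zero _)
    · exact hX' i (Nat.lt_of_succ_lt_succ hi)
  · exact hex.comp_injective g0 hg0 (map_zero g0)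
  · rintro (_ | i)
    · exact (hp.comp_exact_iff_exact).2 he0
    · exact he i

/-- Truncation of an infinite `add T`-coresolution at a cosyzygy lying in `add T`. -/
theorem hasFiniteAddCoresolution_of_memAdd_ker {A : Type u} [Ring A] {T : ModuleCat.{u} A}
    (n : ℕ) : ∀ {B : ModuleCat.{u} A} (X : ℕ → ModuleCat.{u} A)
    (g : ∀ i, ↥(X i) →ₗ[A] ↥(X (i + 1))) (g0 : ↥B →ₗ[A] ↥(X 0)), (∀ i, MemAdd A T (X i)) →
    Function.Injective g0 → Function.Exact g0 (g 0) →
    (∀ i, Function.Exact (g i) (g (i + 1))) →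
    MemAdd A T (ModuleCat.of A (LinearMap.ker (g n))) → HasFiniteAddCoresolution A T B n := by
  induction n with
  | zero =>
    intro B X g g0 _ hg0 he0 _ hK
    exact hasFiniteAddCoresolution_zero (hK.of_linearEquiv
      ((LinearEquiv.ofInjective g0 hg0).trans (LinearEquiv.ofEq _ _ he0.linearMap_ker_eq.symm)))
  | succ n ih =>
    intro B X g g0 hX hg0 he0 he hK
    have h := ih (B := ModuleCat.of A (LinearMap.ker (g 1))) (fun i => X (i + 1))
      (fun i => g (i + 1)) (LinearMap.ker (g 1)).subtype (fun i => hX (i + 1))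
      Subtype.val_injective (LinearMap.exact_subtype_ker_map _) (fun i => he (i + 1)) hK
    refine h.cons (hX 0) g0
      ((g 0).codRestrict _ fun x => (he 0).apply_apply_eq_zero x) hg0 ?_ ?_
    · rintro ⟨y, hy⟩
      obtain ⟨x, rfl⟩ := (he 0 y).1 hy
      exact ⟨x, rfl⟩
    · intro x
      rw [← he0 x, Subtype.ext_iff]
      rfl

/-- An infinite `add T`-coresolution whose cosyzygies eventually lie in `add T` can be truncated
at the projective dimension of `T`, if `T` has no self-extensions. -/
theorem hasFiniteAddCoresolution_of_pdLE {A : Type u} [Ring A] {T B : ModuleCat.{u} A} {n : ℕ}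
    (hpd : PdLE A T n) (hT : ∀ i, 0 < i → ExtVanish A i T T) (X : ℕ → ModuleCat.{u} A)
    (g : ∀ i, ↥(X i) →ₗ[A] ↥(X (i + 1))) (g0 : ↥B →ₗ[A] ↥(X 0)) (hX : ∀ i, MemAdd A T (X i))
    (hg0 : Function.Injective g0) (he0 : Function.Exact g0 (g 0))
    (he : ∀ i, Function.Exact (g i) (g (i + 1))) (m : ℕ)
    (hm : MemAdd A T (ModuleCat.of A (LinearMap.ker (g (n + m))))) :
    HasFiniteAddCoresolution A T B n := by
  obtain ⟨P, d, ε, hP, hε, h0, hd, hsub⟩ := hpd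
  have hdd : ∀ i, d i ∘ₗ d (i + 1) = 0 := fun i => (hd i).linearMap_comp_eq_zero
  have hHomX : ∀ i j, HomExact (d (i + 1)) (d i) ↥(X j) := fun i j =>
    HomExact.of_memAdd ((subsingleton_ext_iff P d ε hP hε h0 hd T i).1 (hT (i + 1) i.succ_pos))
      (hX j)
  let p : ∀ j, ↥(X j) →ₗ[A] LinearMap.ker (g (j + 1)) := fun j =>
    (g j).codRestrict _ fun x => (he j).apply_apply_eq_zero x
  have hp : ∀ j, Function.Surjective (p j) := by
    rintro j ⟨y, hy⟩
    obtain ⟨x, rfl⟩ := (he j y).1 hy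
    exact ⟨x, rfl⟩
  have hpex : ∀ j, Function.Exact (LinearMap.ker (g j)).subtype (p j) := by
    intro j x
    rw [← LinearMap.exact_subtype_ker_map (g j) x, Subtype.ext_iff]
    rfl
  have hker : ∀ j i, n ≤ i + j → HomExact (d (i + 1)) (d i) (LinearMap.ker (g j)) := by
    intro j
    induction j with
    | zero =>
      intro i hi f _
      have := hsub (i + 1) (Nat.lt_succ_of_le hi)
      exact ⟨0, LinearMap.ext fun x => by rw [Subsingleton.elim x 0, map_zero, map_zero]⟩
    | succ j ih =>
      intro i hi
      exact HomExact.shift (hdd (i + 1)) Subtype.val_injective (hp j) (hpex j)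
        (ih (i + 1) (by omega)) (hHomX i j)
  have hadd : ∀ e, MemAdd A T (ModuleCat.of A (LinearMap.ker (g (n + e)))) →
      MemAdd A T (ModuleCat.of A (LinearMap.ker (g n))) := by
    intro e
    induction e with
    | zero => exact id
    | succ e ih =>
      intro h
      refine ih ?_
      obtain ⟨s, hs⟩ := h.exists_section (p (n + e)) fun φ =>
        HomExact.exists_lift (hdd 0) Subtype.val_injective (hp (n + e)) (hpex (n + e))
          (hker (n + e) 0 (by omega)) hε h0 φ
      have hmem : ∀ x, (LinearMap.id - s ∘ₗ p (n + e) : Module.End A ↥(X (n + e))) x ∈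
          LinearMap.ker (g (n + e)) := fun x => by
        have h1 : p (n + e) (x - s (p (n + e) x)) = 0 := by
          rw [map_sub, sub_eq_zero]
          exact (LinearMap.congr_fun hs (p (n + e) x)).symm
        exact congrArg Subtype.val h1
      refine (hX (n + e)).of_retract (LinearMap.ker (g (n + e))).subtype
        ((LinearMap.id - s ∘ₗ p (n + e)).codRestrict _ hmem) ?_
      refine LinearMap.ext fun x => Subtype.ext ?_
      have h1 : p (n + e) x.1 = 0 := Subtype.ext x.2
      change x.1 - s (p (n + e) x.1) = x.1
      rw [h1, map_zero, sub_zero]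
  exact hasFiniteAddCoresolution_of_memAdd_ker n X g g0 hX hg0 he0 he (hadd m hm)

/-- second half of the proof of Theorem 2.18. Let `T` be a Wakamatsu
tilting (semidualizing) `(S,R)`-bimodule. If `pd(_S T) < ∞` and `pd(T_R) = n < ∞`, then
`T` is an `n`-tilting right `R`-module. -/
theorem isNTilting_of_finite_pd_both_sides
    (S R : Type u) [Ring S] [Ring R] (T : Type u) [AddCommGroup T] [Module S T]
    [Module Rᵐᵒᵖ T] [SMulCommClass S Rᵐᵒᵖ T]
    (hsd : IsSemidualizing S R T)
    (hpdS : ∃ m : ℕ, PdLE S (ModuleCat.of S T) m)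
    (n : ℕ) (hpdR : PdEq Rᵐᵒᵖ (ModuleCat.of Rᵐᵒᵖ T) n) :
    IsNTilting Rᵐᵒᵖ (ModuleCat.of Rᵐᵒᵖ T) n := by
  obtain ⟨hgenA, ⟨Q, f, f0, hQ, hf0, hff0, hff, -⟩, -, hbij, hextA, hextS⟩ := hsd
  refine ⟨hgenA, hpdR.1, hextA, ?_⟩
  obtain ⟨m, P, d, ε, hP, hε, h0, hd, hsub⟩ := hpdS
  have hQproj : ∀ i, Module.Projective S ↥(Q i) := fun i => (hQ i).projective
  have hQhom : ∀ i, HomExact (f (i + 1)) (f i) T := fun i =>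
    (subsingleton_ext_iff Q f f0 hQproj hf0 hff0 hff (ModuleCat.of S T) i).1
      (hextS (i + 1) i.succ_pos)
  have hker : HomExact (f (n + m + 1)) (f (n + m)) (LinearMap.range (f (n + m))) := by
    refine (subsingleton_ext_iff Q f f0 hQproj hf0 hff0 hff
      (ModuleCat.of S (LinearMap.range (f (n + m)))) (n + m)).1 ?_
    refine (subsingleton_ext_iff P d ε hP hε h0 hd _ (n + m)).2 fun φ _ => ⟨0, ?_⟩
    have := hsub (n + m + 1) (by omega)
    exact LinearMap.ext fun x => by rw [Subsingleton.elim x 0, map_zero, map_zero]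
  obtain ⟨ρ, hρ⟩ := hker (f (n + m)).rangeRestrict (LinearMap.ext fun x =>
    Subtype.ext ((hff (n + m)).apply_apply_eq_zero x))
  let X : ℕ → ModuleCat.{u} Rᵐᵒᵖ := fun i => ModuleCat.of Rᵐᵒᵖ (↥(Q i) →ₗ[S] T)
  let g : ∀ i, ↥(X i) →ₗ[Rᵐᵒᵖ] ↥(X (i + 1)) := fun i =>
    { toFun := fun h => h ∘ₗ f i
      map_add' := fun _ _ => rfl
      map_smul' := fun _ _ => rfl }
  let g0 : Rᵐᵒᵖ →ₗ[Rᵐᵒᵖ] ↥(X 0) :=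
    { toFun := fun a => rightEndNat S R T a ∘ₗ f0
      map_add' := fun a b => by rw [map_add]; rfl
      map_smul' := fun a b => by rw [smul_eq_mul, map_mul]; rfl }
  refine hasFiniteAddCoresolution_of_pdLE (B := ModuleCat.of Rᵐᵒᵖ Rᵐᵒᵖ) hpdR.1 hextA X g g0
    (fun i => (hQ i).hom) ?_ ?_ ?_ m ?_
  · intro a b hab
    refine hbij.1 (LinearMap.ext fun t => ?_)
    obtain ⟨x, rfl⟩ := hf0 t
    have hab' : rightEndNat S R T a ∘ₗ f0 = rightEndNat S R T b ∘ₗ f0 := hab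
    exact LinearMap.congr_fun hab' x
  · intro h
    constructor
    · intro hh
      obtain ⟨ψ, hψ⟩ := exists_factor_of_exact hf0 hff0 h hh
      obtain ⟨a, rfl⟩ := hbij.2 ψ
      exact ⟨a, hψ⟩
    · rintro ⟨a, rfl⟩
      change (rightEndNat S R T a ∘ₗ f0) ∘ₗ f 0 = 0
      rw [LinearMap.comp_assoc, hff0.linearMap_comp_eq_zero, LinearMap.comp_zero]
  · intro i h
    constructor
    · exact hQhom i h
    · rintro ⟨b, rfl⟩
      change (b ∘ₗ f i) ∘ₗ f (i + 1) = 0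
      rw [LinearMap.comp_assoc, (hff i).linearMap_comp_eq_zero, LinearMap.comp_zero]
  · let σ : ↥(Q (n + m)) →ₗ[S] ↥(Q (n + m)) :=
      LinearMap.id - (LinearMap.range (f (n + m))).subtype ∘ₗ ρ
    have hσf : σ ∘ₗ f (n + m) = 0 := by
      rw [LinearMap.sub_comp, LinearMap.comp_assoc, hρ]
      exact sub_self _
    have hσ : ∀ h : ↥(Q (n + m)) →ₗ[S] T, h ∘ₗ f (n + m) = 0 → h ∘ₗ σ = h := by
      intro h hh
      refine LinearMap.ext fun x => ?_
      obtain ⟨y, hy⟩ := (ρ x).2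
      change h (x - (ρ x).1) = h x
      rw [map_sub, ← hy]
      exact (congrArg (h x - ·) (LinearMap.congr_fun hh y)).trans (sub_zero _)
    let r : ↥(X (n + m)) →ₗ[Rᵐᵒᵖ] ↥(X (n + m)) :=
      { toFun := fun h => h ∘ₗ σ
        map_add' := fun _ _ => rfl
        map_smul' := fun _ _ => rfl }
    have hr : ∀ h, r h ∈ LinearMap.ker (g (n + m)) := fun h => by
      change (h ∘ₗ σ) ∘ₗ f (n + m) = 0
      rw [LinearMap.comp_assoc, hσf, LinearMap.comp_zero]
    exact (hQ (n + m)).hom.of_retract (LinearMap.ker (g (n + m))).subtype (r.codRestrict _ hr)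
      (LinearMap.ext fun h => Subtype.ext (hσ h.1 h.2))
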